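/- arXiv:1304.1592 — 5 statements merged into one kernel-verified Lean document; each statement's English description precedes it below -/
import Mathlib

section
/- Let p : ℕ → ℝ with p(n) ≥ 0 for all n. Define T_p : (ℕ×ℕ) × (ℕ×ℕ) → ℝ by T_p((a,b),(c,d)) = p(a+d) · 2^{-(a+d)} · √(C(a+d, a) · C(a+d, b)) if a + d = b + c, and 0 otherwise. If both infinite Hankel matrices H_0 = [p(k+l)]_{k,l∈ℕ} and H_1 = [p(1+k+l)]_{k,l∈ℕ} are positive semidefinite (in the finitely-supported quadratic form sense), then T_p is positive semidefinite: for every finitely supported x : ℕ×ℕ → ℝ, Σ_{u,v} x(u)·T_p(u,v)·x(v) ≥ 0. -/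
/-- The partial transpose, in the Fock basis, of the two-mode state obtained by sending a
one-mode state with photon-number distribution `p` through a 50:50 beam splitter together
with the vacuum:
`T_p((a,b),(c,d)) = p(a+d) · 2^{-(a+d)} · √(C(a+d,a)·C(a+d,b))` if `a+d = b+c`, else `0`. -/
noncomputable def Tp (p : ℕ → ℝ) (u v : ℕ × ℕ) : ℝ :=
  if u.1 + v.2 = u.2 + v.1 then
    p (u.1 + v.2) * (2 : ℝ) ^ (-((u.1 + v.2 : ℕ) : ℤ)) *
      Real.sqrt ((Nat.choose (u.1 + v.2) u.1 : ℝ) * (Nat.choose (u.1 + v.2) u.2 : ℝ))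
  else 0

open Matrix in
/-- A shifted Hankel matrix of a sequence is a submatrix of one of the two basic Hankel matrices. -/
theorem posSemidef_hankel_shift {p : ℕ → ℝ}
    (h0 : (of fun k l : ℕ => p (k + l)).PosSemidef)
    (h1 : (of fun k l : ℕ => p (1 + k + l)).PosSemidef) (s : ℕ) :
    (of fun k l : ℕ => p (k + l + s)).PosSemidef := by
  obtain ⟨e, rfl | rfl⟩ := s.even_or_odd'
  · convert h0.submatrix (· + e) using 1
    ext k l
    simp only [of_apply, submatrix_apply]
    congr 1
    ring
  · convert h1.submatrix (· + e) using 1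
    ext k l
    simp only [of_apply, submatrix_apply]
    congr 1
    ring

open Matrix in
/-- A symmetric real matrix with nonnegative finitely supported quadratic form, written as an
explicit double sum, is positive semidefinite. -/
theorem posSemidef_of_sum_nonneg {ι : Type*} {M : ι → ι → ℝ} (hM : ∀ i j, M i j = M j i)
    (h : ∀ x : ι →₀ ℝ, 0 ≤ ∑ k ∈ x.support, ∑ l ∈ x.support, x k * M k l * x l) :
    (of M).PosSemidef :=
  ⟨by ext i j; simp [hM i j], fun x => by simpa [Finsupp.sum] using h x⟩

open Matrix in
theorem posSemidef_mul_self {ι : Type*} (w : ι → ℝ) : (of fun i j => w i * w j).PosSemidef := by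
  refine posSemidef_of_sum_nonneg (fun i j => mul_comm _ _) fun x => ?_
  have : ∑ i ∈ x.support, ∑ j ∈ x.support, x i * (w i * w j) * x j =
      (∑ i ∈ x.support, x i * w i) ^ 2 := by
    rw [sq, Finset.sum_mul_sum]
    refine Finset.sum_congr rfl fun i _ => Finset.sum_congr rfl fun j _ => ?_
    ring
  rw [this]
  positivity

theorem integrableOn_exp_neg_mul_pow (n : ℕ) :
    MeasureTheory.IntegrableOn (fun t : ℝ => Real.exp (-t) * t ^ n) (Set.Ioi 0) := by
  simpa using Real.GammaIntegral_convergent (s := n + 1) (by positivity)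

theorem integral_exp_neg_mul_pow (n : ℕ) :
    ∫ t in Set.Ioi (0 : ℝ), Real.exp (-t) * t ^ n = n.factorial := by
  rw [← Real.Gamma_nat_eq_factorial, Real.Gamma_eq_integral (by positivity)]
  simp

open Matrix in
/-- The factorials are Stieltjes moments, so their shifted Hankel matrices are positive
semidefinite. -/
theorem posSemidef_hankel_factorial (s : ℕ) :
    (of fun k l : ℕ => ((k + l + s).factorial : ℝ)).PosSemidef := by
  refine posSemidef_of_sum_nonneg (fun k l => by rw [add_comm k l]) fun x => ?_
  have hint (k l : ℕ) : MeasureTheory.IntegrableOn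
      (fun t : ℝ => x k * (Real.exp (-t) * t ^ (k + l + s)) * x l) (Set.Ioi 0) :=
    ((integrableOn_exp_neg_mul_pow (k + l + s)).const_mul _).mul_const _
  have key : ∑ k ∈ x.support, ∑ l ∈ x.support, x k * ((k + l + s).factorial : ℝ) * x l =
      ∫ t in Set.Ioi (0 : ℝ), ∑ k ∈ x.support, ∑ l ∈ x.support,
        x k * (Real.exp (-t) * t ^ (k + l + s)) * x l := by
    rw [MeasureTheory.integral_finsetSum _ fun k _ =>
      MeasureTheory.integrable_finsetSum _ fun l _ => hint k l]
    refine Finset.sum_congr rfl fun k _ => ?_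
    rw [MeasureTheory.integral_finsetSum _ fun l _ => hint k l]
    refine Finset.sum_congr rfl fun l _ => ?_
    rw [MeasureTheory.integral_mul_const, MeasureTheory.integral_const_mul,
      integral_exp_neg_mul_pow]
  rw [key]
  refine MeasureTheory.setIntegral_nonneg measurableSet_Ioi fun t (ht : 0 < t) => ?_
  have : ∑ k ∈ x.support, ∑ l ∈ x.support, x k * (Real.exp (-t) * t ^ (k + l + s)) * x l =
      Real.exp (-t) * t ^ s * (∑ k ∈ x.support, x k * t ^ k) ^ 2 := by
    rw [sq, Finset.sum_mul_sum, Finset.mul_sum]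
    refine Finset.sum_congr rfl fun k _ => ?_
    rw [Finset.mul_sum]
    refine Finset.sum_congr rfl fun l _ => ?_
    ring
  rw [this]
  positivity

open Matrix in
/-- A matrix that is block diagonal along the fibres of `f`, with each block the restriction of a
positive semidefinite matrix, is positive semidefinite. -/
theorem posSemidef_of_fibers {ι κ : Type*} [DecidableEq κ] (f : ι → κ) {K : κ → Matrix ι ι ℝ}
    (hK : ∀ k, (K k).PosSemidef) :
    (of fun i j => if f i = f j then K (f i) i j else 0).PosSemidef := by
  refine posSemidef_of_sum_nonneg (fun i j => ?_) fun x => ?_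
  · by_cases h : f i = f j
    · simpa [h] using (hK (f j)).isHermitian.apply j i
    · simp [h, Ne.symm h]
  · have hS := posSemidef_sum (x.support.image f) fun k _ =>
      ((PosSemidef.diagonal (d := Pi.single k (1 : ℝ))
        (Pi.single_nonneg.2 zero_le_one)).submatrix f).hadamard (hK k)
    refine (hS.2 x).trans_eq (Finset.sum_congr rfl fun i hi => Finset.sum_congr rfl fun j _ => ?_)
    have hf : f i ∈ x.support.image f := Finset.mem_image_of_mem f hi
    simp only [Matrix.sum_apply, hadamard_apply, submatrix_apply, diagonal_apply, star_trivial]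
    split_ifs with h
    · rw [Finset.sum_eq_single_of_mem _ hf fun k _ hk => by simp [Pi.single_eq_of_ne' hk]]
      simp
    · simp

/-- The binomial weight in `Tp` splits, up to a factorial, as a product of one-index weights. -/
theorem factorial_mul_weight_eq {a b c d n : ℕ} (h₁ : a + d = n) (h₂ : b + c = n) :
    (2 : ℝ) ^ (-(n : ℤ)) * Real.sqrt ((n.choose a : ℝ) * n.choose b) =
      (Real.sqrt (2 ^ (a + b) * a.factorial * b.factorial))⁻¹ *
        (Real.sqrt (2 ^ (c + d) * c.factorial * d.factorial))⁻¹ * n.factorial := by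
  have ha : (n.choose a : ℝ) = n.factorial / (a.factorial * d.factorial) := by
    rw [← h₁, Nat.cast_add_choose]
  have hb : (n.choose b : ℝ) = n.factorial / (b.factorial * c.factorial) := by
    rw [← h₂, Nat.cast_add_choose]
  have hpow : (2 : ℝ) ^ (a + b) * 2 ^ (c + d) = (2 ^ n) ^ 2 := by
    rw [← pow_add, ← pow_mul]
    congr 1
    omega
  rw [← sq_eq_sq₀ (by positivity) (by positivity), mul_pow, mul_pow, mul_pow, inv_pow, inv_pow,
    Real.sq_sqrt (by positivity), Real.sq_sqrt (by positivity), Real.sq_sqrt (by positivity),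
    ha, hb, zpow_neg, zpow_natCast, inv_pow, ← hpow]
  field_simp

open Matrix in
theorem posSemidef_Tp {p : ℕ → ℝ}
    (h0 : (of fun k l : ℕ => p (k + l)).PosSemidef)
    (h1 : (of fun k l : ℕ => p (1 + k + l)).PosSemidef) : (of (Tp p)).PosSemidef := by
  let w : ℕ × ℕ → ℝ := fun u =>
    (Real.sqrt (2 ^ (u.1 + u.2) * u.1.factorial * u.2.factorial))⁻¹
  have hblock (s : ℤ) := ((posSemidef_hankel_shift h0 h1 s.natAbs).hadamard
    (posSemidef_hankel_factorial s.natAbs)).submatrix fun u : ℕ × ℕ => min u.1 u.2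
  refine (congrArg PosSemidef ?_).mpr
    ((posSemidef_of_fibers (fun u : ℕ × ℕ => (u.1 : ℤ) - u.2) hblock).hadamard
      (posSemidef_mul_self w))
  ext ⟨a, b⟩ ⟨c, d⟩
  simp only [Tp, of_apply, hadamard_apply, submatrix_apply]
  by_cases h : a + d = b + c
  · have hn : min a b + min c d + ((a : ℤ) - b).natAbs = a + d := by omega
    rw [if_pos h, if_pos (by omega), hn, mul_assoc, factorial_mul_weight_eq rfl h.symm]
    ring
  · rw [if_neg h, if_neg (by omega), zero_mul]

/-- Proposition 1: if the Hankel matrices `[p(k+l)]` and `[p(1+k+l)]` are positive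
semidefinite (in the finitely-supported quadratic form sense), then the partial transpose
`T_p` is positive semidefinite. -/
theorem partialTranspose_posSemidef_of_hankel_posSemidef
    (p : ℕ → ℝ) (hp : ∀ n, 0 ≤ p n)
    (hH0 : ∀ x : ℕ →₀ ℝ,
      0 ≤ ∑ k ∈ x.support, ∑ l ∈ x.support, x k * p (k + l) * x l)
    (hH1 : ∀ x : ℕ →₀ ℝ,
      0 ≤ ∑ k ∈ x.support, ∑ l ∈ x.support, x k * p (1 + k + l) * x l) :
    ∀ x : (ℕ × ℕ) →₀ ℝ,
      0 ≤ ∑ u ∈ x.support, ∑ v ∈ x.support, x u * Tp p u v * x v := by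
  intro x
  have h0 := posSemidef_of_sum_nonneg (fun k l => by rw [add_comm k l]) hH0
  have h1 := posSemidef_of_sum_nonneg (fun k l => by rw [add_right_comm 1 k l]) hH1
  simpa [Finsupp.sum] using (posSemidef_Tp h0 h1).2 x
end

section
/- For each j ∈ ℕ, the infinite matrix B_j with entries (B_j)_{k,l} = 2^{-(j+k+l)} · √(C(j+k+l, j+k) · C(j+k+l, k)) for k, l ∈ ℕ is positive definite: for every nonzero finitely supported x : ℕ → ℝ, Σ_{k,l} x(k)·(B_j)_{k,l}·x(l) > 0. -/
open Finset Nat in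
/-- Chu–Vandermonde, in a form symmetric in `k` and `l`. -/
theorem factorial_add_add_eq_sum (j k l N : ℕ) (hl : l ≤ N) :
    ((j + k + l)! : ℝ) = ∑ m ∈ range (N + 1),
      (m ! / (j + m)! : ℝ) * (((j + k)! : ℝ) * k.choose m) * (((j + l)! : ℝ) * l.choose m) := by
  have choose_shift (m : ℕ) (hm : m ≤ l) :
      ((j + l).choose (l - m) : ℝ) = l.choose m * (j + l)! * m ! / (l ! * (j + m)!) := by
    have h : j + l - (l - m) = j + m := by lia
    rw [Nat.cast_choose ℝ hm, Nat.cast_choose ℝ (by lia : l - m ≤ j + l), h]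
    field_simp
  have vandermonde : ((j + k + l).choose l : ℝ) =
      ∑ m ∈ range (l + 1), (k.choose m : ℝ) * (j + l).choose (l - m) := by
    rw [show j + k + l = k + (j + l) by ring, Nat.add_choose_eq,
      Finset.Nat.sum_antidiagonal_eq_sum_range_succ_mk]
    push_cast
    rfl
  have hfact : ((j + k + l)! : ℝ) = (j + k + l).choose l * ((j + k)! * l !) := by
    rw [Nat.cast_choose ℝ (Nat.le_add_left l (j + k)), Nat.add_sub_cancel]
    field_simp
  rw [hfact, vandermonde, sum_mul]
  refine (sum_congr rfl fun m hm => ?_).trans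
    (sum_subset (range_mono (by lia : l + 1 ≤ N + 1)) fun m _ hm => ?_)
  · rw [choose_shift m (by simpa [Nat.lt_succ_iff] using hm)]
    field_simp
  · rw [Nat.choose_eq_zero_of_lt (by simpa [Nat.lt_succ_iff] using hm : l < m)]
    simp

open Nat in
theorem sqrt_choose_mul_choose (j k l : ℕ) :
    √(((j + k + l).choose (j + k) : ℝ) * ((j + k + l).choose k : ℝ)) =
      (j + k + l)! / (√((k ! : ℝ) * (j + k)!) * √((l ! : ℝ) * (j + l)!)) := by
  have h₁ : j + k + l - (j + k) = l := by lia
  have h₂ : j + k + l - k = j + l := by lia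
  rw [Nat.cast_choose ℝ (by lia : j + k ≤ j + k + l), Nat.cast_choose ℝ (by lia : k ≤ j + k + l),
    h₁, h₂, ← Real.sqrt_mul (by positivity), Real.sqrt_eq_iff_mul_self_eq (by positivity)
      (by positivity), _root_.div_mul_div_comm, _root_.div_mul_div_comm,
    Real.mul_self_sqrt (by positivity)]
  field_simp

/-- Lemma 1: for each `j`, the infinite matrix `B_j` with entries
`(B_j)_{k,l} = 2^{-(j+k+l)} · √(C(j+k+l, j+k) · C(j+k+l, k))` is positive definite
in the finitely-supported sense. -/
theorem Bmatrix_posDef (j : ℕ) :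
    ∀ x : ℕ →₀ ℝ, x ≠ 0 →
      0 < ∑ k ∈ x.support, ∑ l ∈ x.support,
        x k *
          ((2 : ℝ) ^ (-((j + k + l : ℕ) : ℤ)) *
            Real.sqrt ((Nat.choose (j + k + l) (j + k) : ℝ) *
              (Nat.choose (j + k + l) k : ℝ))) *
        x l := by
  intro x hx
  have hne : x.support.Nonempty := Finsupp.support_nonempty_iff.mpr hx
  set N := x.support.max' hne
  have le_N {k : ℕ} (hk : k ∈ x.support) : k ≤ N := x.support.le_max' k hk
  let c (k : ℕ) : ℝ := x k * (2 ^ k)⁻¹ / √((k.factorial : ℝ) * (j + k).factorial)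
  let s (m : ℕ) : ℝ := ∑ k ∈ x.support, c k * ((j + k).factorial * k.choose m)
  have sum_of_squares : (∑ k ∈ x.support, ∑ l ∈ x.support,
      x k * ((2 : ℝ) ^ (-((j + k + l : ℕ) : ℤ)) * Real.sqrt ((Nat.choose (j + k + l) (j + k) : ℝ) *
        (Nat.choose (j + k + l) k : ℝ))) * x l) =
      (2 ^ j)⁻¹ * ∑ m ∈ Finset.range (N + 1),
        (m.factorial / (j + m).factorial : ℝ) * (s m * s m) := by
    have entry (k l : ℕ) (hl : l ∈ x.support) :
        x k * ((2 : ℝ) ^ (-((j + k + l : ℕ) : ℤ)) *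
          Real.sqrt ((Nat.choose (j + k + l) (j + k) : ℝ) *
            (Nat.choose (j + k + l) k : ℝ))) * x l =
        ∑ m ∈ Finset.range (N + 1), (2 ^ j)⁻¹ * ((m.factorial / (j + m).factorial : ℝ) *
          (c k * ((j + k).factorial * k.choose m) * (c l * ((j + l).factorial * l.choose m)))) := by
      calc
        _ = (2 ^ j)⁻¹ * c k * c l * ((j + k + l).factorial : ℝ) := by
          rw [sqrt_choose_mul_choose, zpow_neg, zpow_natCast, pow_add, pow_add, mul_inv, mul_inv]
          simp only [c]
          ring
        _ = _ := by
          rw [factorial_add_add_eq_sum j k l N (le_N hl), Finset.mul_sum]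
          exact Finset.sum_congr rfl fun m _ => by ring
    rw [Finset.sum_congr rfl fun k _ => Finset.sum_congr rfl fun l hl => entry k l hl]
    simp only [s, Finset.sum_mul_sum]
    simp only [Finset.mul_sum]
    rw [Finset.sum_congr rfl fun k _ => Finset.sum_comm, Finset.sum_comm]
  have s_N : s N = c N * (j + N).factorial := by
    have h : s N = c N * ((j + N).factorial * N.choose N) :=
      Finset.sum_eq_single_of_mem N (x.support.max'_mem hne) fun k hk hkN => by
        rw [Nat.choose_eq_zero_of_lt (lt_of_le_of_ne (le_N hk) hkN)]
        simp
    simpa using h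
  have s_N_ne : s N ≠ 0 := by
    have hxN : x N ≠ 0 := Finsupp.mem_support_iff.mp (x.support.max'_mem hne)
    rw [s_N]
    simp only [c]
    positivity
  rw [sum_of_squares]
  refine mul_pos (by positivity) (Finset.sum_pos' (fun m _ => ?_) ⟨N, by simp, ?_⟩)
  · exact mul_nonneg (by positivity) (mul_self_nonneg _)
  · exact mul_pos (by positivity) (mul_self_pos.mpr s_N_ne)
end

section
/- For each j ∈ ℕ, the infinite Hankel matrix C_j with entries (C_j)_{k,l} = (j+k+l)! for k, l ∈ ℕ is positive definite: for every nonzero finitely supported x : ℕ → ℝ, Σ_{k,l} x(k)·(j+k+l)!·x(l) > 0. -/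
open MeasureTheory Set

theorem integrableOn_pow_mul_exp_neg (n : ℕ) :
    IntegrableOn (fun t : ℝ => t ^ n * Real.exp (-t)) (Ioi 0) := by
  have h := Real.GammaIntegral_convergent (s := (n : ℝ) + 1) (by positivity)
  simpa [mul_comm] using h

theorem integral_pow_mul_exp_neg (n : ℕ) :
    ∫ t in Ioi (0 : ℝ), t ^ n * Real.exp (-t) = (Nat.factorial n : ℝ) := by
  rw [← Real.Gamma_nat_eq_factorial, Real.Gamma_eq_integral (by positivity)]
  simp [mul_comm]

theorem setIntegral_eval_sq_mul_pow_mul_exp_neg_pos {p : Polynomial ℝ} (hp : p ≠ 0) (j : ℕ)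
    (hint : IntegrableOn (fun t : ℝ => p.eval t ^ 2 * (t ^ j * Real.exp (-t))) (Ioi 0)) :
    0 < ∫ t in Ioi (0 : ℝ), p.eval t ^ 2 * (t ^ j * Real.exp (-t)) := by
  rw [setIntegral_pos_iff_support_of_nonneg_ae _ hint]
  · have hroots : volume {t : ℝ | p.IsRoot t} = 0 :=
      (Polynomial.finite_setOfPred_isRoot hp).measure_zero _
    calc (0 : ENNReal) < volume (Ioi (0 : ℝ)) := by simp
      _ = volume (Ioi (0 : ℝ) \ {t | p.IsRoot t}) := (measure_sdiff_null hroots).symm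
      _ ≤ _ := measure_mono ?_
    rintro t ⟨ht, hroot⟩
    have ht0 : t ≠ 0 := ne_of_gt ht
    exact ⟨mul_ne_zero (pow_ne_zero 2 hroot)
      (mul_ne_zero (pow_ne_zero j ht0) (Real.exp_ne_zero _)), ht⟩
  · filter_upwards [ae_restrict_mem measurableSet_Ioi] with t ht
    have ht0 : 0 < t := ht
    simp only [Pi.zero_apply]
    positivity

/-- The infinite Hankel matrix `C_j` with entries `(C_j)_{k,l} = (j+k+l)!` is positive
definite in the finitely-supported sense (a step in the proof of Lemma 1). -/
theorem factorialHankel_posDef (j : ℕ) :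
    ∀ x : ℕ →₀ ℝ, x ≠ 0 →
      0 < ∑ k ∈ x.support, ∑ l ∈ x.support,
        x k * (Nat.factorial (j + k + l) : ℝ) * x l := by
  intro x hx
  let p : Polynomial ℝ := ∑ k ∈ x.support, Polynomial.monomial k (x k)
  have hp : p ≠ 0 := by
    obtain ⟨n, hn⟩ := Finsupp.ne_iff.mp hx
    intro h
    apply hn
    simpa [p, Polynomial.finsetSum_coeff, Polynomial.coeff_monomial] using
      congrArg (fun q => Polynomial.coeff q n) h
  have hexpand (t : ℝ) : p.eval t ^ 2 * (t ^ j * Real.exp (-t)) =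
      ∑ k ∈ x.support, ∑ l ∈ x.support,
        x k * x l * (t ^ (j + k + l) * Real.exp (-t)) := by
    simp only [p, Polynomial.eval_finsetSum, Polynomial.eval_monomial, sq, Finset.mul_sum,
      Finset.sum_mul]
    refine Finset.sum_congr rfl fun k _ => Finset.sum_congr rfl fun l _ => ?_
    ring
  have hterm (k l : ℕ) : IntegrableOn
      (fun t : ℝ => x k * x l * (t ^ (j + k + l) * Real.exp (-t))) (Ioi 0) :=
    (integrableOn_pow_mul_exp_neg _).const_mul _
  have hpos := setIntegral_eval_sq_mul_pow_mul_exp_neg_pos hp j <| by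
    simp only [hexpand]
    exact integrable_finsetSum _ fun k _ => integrable_finsetSum _ fun l _ => hterm k l
  simp only [hexpand] at hpos
  rw [integral_finsetSum _ fun k _ => integrable_finsetSum _ fun l _ => hterm k l] at hpos
  convert hpos using 2 with k
  rw [integral_finsetSum _ fun l _ => hterm k l]
  refine Finset.sum_congr rfl fun l _ => ?_
  rw [integral_const_mul, integral_pow_mul_exp_neg]
  ring
end

section
/- Let p : ℕ → ℝ with p(n) ≥ 0 for all n, p(0) = 0 and p(1) > 0. Then the matrix T_p is not positive semidefinite: there exists a finitely supported x : ℕ×ℕ → ℝ with Σ_{u,v} x(u)·T_p(u,v)·x(v) < 0. In particular, for the shifted thermal distribution p(0) = 0, p(n) = (1/(n̄+1))·(n̄/(n̄+1))^{n-1} for n ≥ 1 (with n̄ > 0), the corresponding two-mode beam-splitter output state is negative under partial transposition (NPT). -/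
/-- Shifted thermal distribution with mean photon number `n̄`:
`p(0) = 0` and `p(n) = (1/(n̄+1))·(n̄/(n̄+1))^{n-1}` for `n ≥ 1`. -/
noncomputable def pShiftedThermal (nbar : ℝ) : ℕ → ℝ := fun n =>
  if n = 0 then 0 else (1 / (nbar + 1)) * (nbar / (nbar + 1)) ^ (n - 1)

/-- A finitely supported vector on `{(0,0), (1,1)}` witnesses the negativity of `Tp p` when `p`
vanishes at `0` but not at `1`. -/
theorem exists_Tp_form_neg (p : ℕ → ℝ) (hp : ∀ n, 0 ≤ p n) (h0 : p 0 = 0) (h1 : 0 < p 1) :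
    ∃ x : (ℕ × ℕ) →₀ ℝ,
      (∑ u ∈ x.support, ∑ v ∈ x.support, x u * Tp p u v * x v) < 0 := by
  have h2 := hp 2
  have hsqrt : Real.sqrt (2 * 2) = 2 := Real.sqrt_mul_self zero_le_two
  have h00 : Tp p (0, 0) (0, 0) = 0 := by simp [Tp, h0]
  have h01 : Tp p (0, 0) (1, 1) = p 1 / 2 := by simp [Tp, div_eq_mul_inv]
  have h10 : Tp p (1, 1) (0, 0) = p 1 / 2 := by simp [Tp, div_eq_mul_inv]
  have h11 : Tp p (1, 1) (1, 1) = p 2 / 2 := by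
    simp only [Tp, if_true, Nat.reduceAdd, Nat.choose_one_right, Nat.cast_ofNat, hsqrt]
    norm_num [zpow_neg]
    ring
  let x : (ℕ × ℕ) →₀ ℝ :=
    Finsupp.single (0, 0) (-(p 2 + p 1)) + Finsupp.single (1, 1) (p 1)
  have hx0 : x (0, 0) = -(p 2 + p 1) := by simp [x]
  have hx1 : x (1, 1) = p 1 := by simp [x]
  have hsupp : x.support = {(0, 0), (1, 1)} := by
    ext u
    rw [Finsupp.mem_support_iff, Finset.mem_insert, Finset.mem_singleton]
    constructor
    · contrapose!
      rintro ⟨hu0, hu1⟩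
      simp [x, Finsupp.single_eq_of_ne hu0, Finsupp.single_eq_of_ne hu1]
    · rintro (rfl | rfl)
      · rw [hx0]; linarith
      · rw [hx1]; exact h1.ne'
  refine ⟨x, ?_⟩
  have hne : ((0, 0) : ℕ × ℕ) ≠ (1, 1) := by decide
  rw [hsupp]
  simp only [Finset.sum_pair hne, h00, h01, h10, h11, hx0, hx1]
  have hpos : 0 < p 1 ^ 2 * (p 1 + p 2 / 2) := by positivity
  linarith

/-- If `p(0) = 0` and `p(1) > 0`, the partial transpose `T_p` is not positive semidefinite;
in particular, for every shifted thermal distribution (with `n̄ > 0`) the corresponding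
two-mode beam-splitter output state is NPT. -/
theorem shiftedVacuum_output_NPT :
    (∀ p : ℕ → ℝ, (∀ n, 0 ≤ p n) → p 0 = 0 → 0 < p 1 →
      ∃ x : (ℕ × ℕ) →₀ ℝ,
        (∑ u ∈ x.support, ∑ v ∈ x.support, x u * Tp p u v * x v) < 0) ∧
    (∀ nbar : ℝ, 0 < nbar →
      ∃ x : (ℕ × ℕ) →₀ ℝ,
        (∑ u ∈ x.support, ∑ v ∈ x.support,
          x u * Tp (pShiftedThermal nbar) u v * x v) < 0) := by
  refine ⟨exists_Tp_form_neg, fun nbar hn => exists_Tp_form_neg _ (fun n => ?_) ?_ ?_⟩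
  · unfold pShiftedThermal
    split_ifs <;> positivity
  · simp [pShiftedThermal]
  · simp only [pShiftedThermal, one_ne_zero, if_false]
    positivity
end

section
/- Fix n̄ > 0 and let p^{(n̄)}(0) = 0, p^{(n̄)}(n) = (1/(n̄+1))·(n̄/(n̄+1))^{n-1} for n ≥ 1 (shifted thermal distribution), and q(0) = 0, q(n) = 2^{-n} for n ≥ 1. With d(n) = ((n̄+1)/(2n̄))^{n/2}, one has for all a, b, c, e ∈ ℕ the congruence identity d(a)·d(b)·d(c)·d(e)·T_{p^{(n̄)}}((a,b),(c,e)) = (1/n̄)·T_q((a,b),(c,e)). Consequently, T_{p^{(n̄)}} is positive semidefinite (in the finitely-supported quadratic form sense) if and only if T_q is. -/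
/-- Shifted thermal distribution with `n̄ = 1`. -/
noncomputable def q : ℕ → ℝ := fun n =>
  if n = 0 then 0 else (2 : ℝ) ^ (-(n : ℤ))

/-- Local diagonal scaling `d(n) = ((n̄+1)/(2n̄))^{n/2}`. -/
noncomputable def dScale (nbar : ℝ) (n : ℕ) : ℝ :=
  ((nbar + 1) / (2 * nbar)) ^ ((n : ℝ) / 2)

theorem dScale_pos {nbar : ℝ} (hnbar : 0 < nbar) (n : ℕ) : 0 < dScale nbar n :=
  Real.rpow_pos_of_pos (by positivity) _

theorem dScale_mul_dScale {nbar : ℝ} (hnbar : 0 < nbar) (m n : ℕ) :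
    dScale nbar m * dScale nbar n = dScale nbar (m + n) := by
  unfold dScale
  rw [← Real.rpow_add (by positivity)]
  congr 1
  push_cast
  ring

theorem dScale_mul_self {nbar : ℝ} (hnbar : 0 < nbar) (n : ℕ) :
    dScale nbar n * dScale nbar n = ((nbar + 1) / (2 * nbar)) ^ n := by
  unfold dScale
  rw [← Real.rpow_add (by positivity), add_halves, Real.rpow_natCast]

theorem pow_mul_pShiftedThermal {nbar : ℝ} (hnbar : 0 < nbar) (n : ℕ) :
    ((nbar + 1) / (2 * nbar)) ^ n * pShiftedThermal nbar n = 1 / nbar * q n := by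
  cases n with
  | zero => simp [pShiftedThermal, q]
  | succ k =>
    have h : (nbar + 1) / (2 * nbar) * (nbar / (nbar + 1)) = 1 / 2 := by field_simp
    simp only [pShiftedThermal, q, Nat.succ_ne_zero, if_false, Nat.add_sub_cancel,
      zpow_neg, zpow_natCast]
    calc
      _ = ((nbar + 1) / (2 * nbar) * (nbar / (nbar + 1))) ^ k *
          ((nbar + 1) / (2 * nbar) * (1 / (nbar + 1))) := by
        rw [mul_pow]
        ring
      _ = 1 / nbar * (2 ^ (k + 1))⁻¹ := by
        rw [h, one_div_pow, pow_succ]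
        field_simp

theorem dScale_mul_Tp_pShiftedThermal {nbar : ℝ} (hnbar : 0 < nbar) (a b c e : ℕ) :
    dScale nbar a * dScale nbar b * dScale nbar c * dScale nbar e *
        Tp (pShiftedThermal nbar) (a, b) (c, e) =
      (1 / nbar) * Tp q (a, b) (c, e) := by
  by_cases h : a + e = b + c
  · have hd : dScale nbar a * dScale nbar b * dScale nbar c * dScale nbar e =
        ((nbar + 1) / (2 * nbar)) ^ (a + e) := by
      rw [← dScale_mul_self hnbar]
      nth_rewrite 2 [h]
      rw [← dScale_mul_dScale hnbar, ← dScale_mul_dScale hnbar]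
      ring
    simp only [Tp, h, if_true] at hd ⊢
    rw [hd, ← mul_assoc, ← mul_assoc, pow_mul_pShiftedThermal hnbar]
    ring
  · simp [Tp, h]

/-- Nonnegativity of a quadratic form on finitely supported vectors is preserved by a
congruence with an invertible diagonal matrix. -/
theorem quadraticForm_nonneg_of_diagonal_congruence {ι : Type*} {K L : ι → ι → ℝ} {w : ι → ℝ}
    (hw : ∀ u, w u ≠ 0) (hKL : ∀ u v, K u v = w u * L u v * w v)
    (hL : ∀ x : ι →₀ ℝ, 0 ≤ ∑ u ∈ x.support, ∑ v ∈ x.support, x u * L u v * x v)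
    (x : ι →₀ ℝ) : 0 ≤ ∑ u ∈ x.support, ∑ v ∈ x.support, x u * K u v * x v := by
  let y : ι →₀ ℝ := ⟨x.support, fun u => w u * x u, fun u => by simp [hw u]⟩
  refine (hL y).trans_eq (Finset.sum_congr rfl fun u _ => Finset.sum_congr rfl fun v _ => ?_)
  change w u * x u * L u v * (w v * x v) = x u * K u v * x v
  rw [hKL]
  ring

/-- Appendix C local-equivalence: every shifted thermal state is locally equivalent, via
the invertible local diagonal operation with weights `d(n) = ((n̄+1)/(2n̄))^{n/2}`, to the
case `n̄ = 1`:
`d(a)·d(b)·d(c)·d(e)·T_{p^{(n̄)}}((a,b),(c,e)) = (1/n̄)·T_q((a,b),(c,e))`,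
and consequently `T_{p^{(n̄)}}` is PSD iff `T_q` is. -/
theorem shiftedThermal_locally_equivalent (nbar : ℝ) (hnbar : 0 < nbar) :
    (∀ a b c e : ℕ,
      dScale nbar a * dScale nbar b * dScale nbar c * dScale nbar e *
          Tp (pShiftedThermal nbar) (a, b) (c, e) =
        (1 / nbar) * Tp q (a, b) (c, e)) ∧
    ((∀ x : (ℕ × ℕ) →₀ ℝ,
        0 ≤ ∑ u ∈ x.support, ∑ v ∈ x.support,
          x u * Tp (pShiftedThermal nbar) u v * x v) ↔
      ∀ x : (ℕ × ℕ) →₀ ℝ,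
        0 ≤ ∑ u ∈ x.support, ∑ v ∈ x.support, x u * Tp q u v * x v) := by
  refine ⟨dScale_mul_Tp_pShiftedThermal hnbar, ?_⟩
  let w : ℕ × ℕ → ℝ := fun u => √nbar * (dScale nbar u.1 * dScale nbar u.2)
  have hw : ∀ u, w u ≠ 0 := fun u =>
    (mul_pos (Real.sqrt_pos.2 hnbar)
      (mul_pos (dScale_pos hnbar u.1) (dScale_pos hnbar u.2))).ne'
  have hq : ∀ u v, Tp q u v = w u * Tp (pShiftedThermal nbar) u v * w v := by
    rintro ⟨a, b⟩ ⟨c, e⟩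
    calc
      Tp q (a, b) (c, e) = nbar * (1 / nbar * Tp q (a, b) (c, e)) := by field_simp
      _ = √nbar * √nbar * (1 / nbar * Tp q (a, b) (c, e)) := by
        rw [Real.mul_self_sqrt hnbar.le]
      _ = _ := by
        rw [← dScale_mul_Tp_pShiftedThermal hnbar]
        ring
  refine ⟨quadraticForm_nonneg_of_diagonal_congruence hw hq,
    quadraticForm_nonneg_of_diagonal_congruence (w := fun u => (w u)⁻¹)
      (fun u => inv_ne_zero (hw u)) fun u v => ?_⟩
  have hu := hw u
  have hv := hw v
  rw [hq]
  field_simp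
end
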